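/- In R = U[[h]] (Jordanian deformation of sl(N), N ≥ 3): for all i, j ∈ {1,…,N-1}, [H_i,H_j] = 0 and [H_i,E_j] = a_{ij}·E_j, where a is the Cartan matrix of sl(N) ([a,b]=ab-ba). -/

import Mathlib

noncomputable section

open LieAlgebra.SpecialLinear

attribute [local instance 100] LieRing.ofAssociativeRing

/-- The generalized binomial coefficient `α(α-1)⋯(α-n+1)/n!`. -/
def qbinom (α : ℚ) (n : ℕ) : ℚ :=
  (∏ i ∈ Finset.range n, (α - (i : ℚ))) / (n.factorial : ℚ)

/-- `U(sl(N,ℂ))`, the universal enveloping algebra of `sl(N,ℂ)`. -/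
abbrev UslN (N : ℕ) : Type := UniversalEnvelopingAlgebra ℂ (sl (Fin N) ℂ)

namespace UslN

variable (N : ℕ)

/-- The canonical embedding `sl(N,ℂ) → U(sl(N,ℂ))`. -/
def ι : sl (Fin N) ℂ →ₗ⁅ℂ⁆ UslN N := UniversalEnvelopingAlgebra.ι ℂ

/-- The Chevalley generator `e i` (0-based: the image of `E_{i,i+1}`, `0 ≤ i ≤ N-2`);
junk value `0` out of range. -/
def e (i : ℕ) : UslN N :=
  if h : i + 1 < N then
    ι N (single ⟨i, Nat.lt_of_succ_lt h⟩ ⟨i + 1, h⟩ (by simp [Fin.ext_iff]) (1 : ℂ))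
  else 0

/-- The Chevalley generator `f i` (0-based: the image of `E_{i+1,i}`, `0 ≤ i ≤ N-2`);
junk value `0` out of range. -/
def f (i : ℕ) : UslN N :=
  if h : i + 1 < N then
    ι N (single ⟨i + 1, h⟩ ⟨i, Nat.lt_of_succ_lt h⟩ (by simp [Fin.ext_iff]) (1 : ℂ))
  else 0

/-- The Chevalley generator `h i` (0-based: the image of `E_{ii} - E_{i+1,i+1}`,
`0 ≤ i ≤ N-2`); junk value `0` out of range. -/
def hgen (i : ℕ) : UslN N :=
  if h : i + 1 < N then
    ι N ⟨Matrix.single ⟨i, Nat.lt_of_succ_lt h⟩ ⟨i, Nat.lt_of_succ_lt h⟩ 1 -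
          Matrix.single ⟨i + 1, h⟩ ⟨i + 1, h⟩ 1,
      show _ ∈ LinearMap.ker (Matrix.traceLinearMap (Fin N) ℂ ℂ) by
        simp [LinearMap.mem_ker, Matrix.trace_single_eq_same]⟩
  else 0

/-- `h₁ + ⋯ + h_{N-1}`. -/
def hsum : UslN N := ∑ i ∈ Finset.range (N - 1), hgen N i

/-- The nested commutators `θ_j := [e_{N-2-j}, [⋯, [e_{N-3}, e_{N-2}]⋯]]` (0-based). -/
def thetaAux : ℕ → UslN N
  | 0 => e N (N - 2)
  | j + 1 =>
      e N (N - 2 - (j + 1)) * thetaAux j - thetaAux j * e N (N - 2 - (j + 1))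

/-- `θ := [e₁,[e₂,⋯,[e_{N-2},e_{N-1}]⋯]]` (1-based), the iterated commutator
corresponding to the highest root. -/
def θ : UslN N := thetaAux N (N - 2)

/-- `δ_i = 1` iff `i` is the first or the last simple-root index (0-based). -/
def δ (i : ℕ) : Prop := i = 0 ∨ i = N - 2

instance (i : ℕ) : Decidable (δ N i) := by unfold δ; infer_instance

/-- `S := Σ_{n≥0} binom(1/2,n) h^{2n} θ^{2n}` in `R = U(sl(N,ℂ))[[h]]`. -/
def S : PowerSeries (UslN N) :=
  PowerSeries.mk fun m =>
    if m % 2 = 0 then ((qbinom (1/2) (m / 2) : ℚ) : ℂ) • θ N ^ m else 0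

/-- `T := h·θ + S`. -/
def T : PowerSeries (UslN N) := PowerSeries.X * PowerSeries.C (θ N) + S N

/-- `T⁻¹ := -h·θ + S`. -/
def Tinv : PowerSeries (UslN N) := -(PowerSeries.X * PowerSeries.C (θ N)) + S N

/-- `T^{1/2} := Σ_{n≥0} binom(1/2,n)(T-1)ⁿ`, well defined since `T - 1` has zero
constant term. -/
def Thalf : PowerSeries (UslN N) :=
  PowerSeries.mk fun m =>
    PowerSeries.coeff m
      (∑ n ∈ Finset.range (m + 1), ((qbinom (1/2) n : ℚ) : ℂ) • (T N - 1) ^ n)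

/-- The `h`-deformed Cartan generators
`H_i := h_i - δ_i·(h/2)·θT⁻¹(h₁+⋯+h_{N-1})` (0-based index). -/
def H (i : ℕ) : PowerSeries (UslN N) :=
  PowerSeries.C (hgen N i) -
    (if δ N i then
      (1/2 : ℂ) • (PowerSeries.X * PowerSeries.C (θ N) * Tinv N *
        PowerSeries.C (hsum N))
    else 0)

/-- The `h`-deformed raising generators `E_i := T^{δ_i/2}·e_i` (0-based index). -/
def E (i : ℕ) : PowerSeries (UslN N) :=
  if δ N i then Thalf N * PowerSeries.C (e N i) else PowerSeries.C (e N i)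

/-- The Cartan matrix of `sl(N)` (0-based indices). -/
def cartan (i j : ℕ) : ℤ :=
  if i = j then 2 else if i + 1 = j ∨ j + 1 = i then -1 else 0

end UslN

open PowerSeries in
/-- For `a` in an `R`-algebra `A`, the algebra morphism `∑ cₙ Xⁿ ↦ ∑ cₙ aⁿ Xⁿ` from `R⟦X⟧` to
`A⟦X⟧`, i.e. the substitution of the element `a X`. -/
def PowerSeries.scaleBy {R A : Type*} [CommSemiring R] [Semiring A] [Algebra R A] (a : A) :
    R⟦X⟧ →ₐ[R] A⟦X⟧ where
  toFun g := mk fun n => coeff n g • a ^ n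
  map_one' := by
    ext n
    by_cases hn : n = 0 <;> simp [coeff_one, hn]
  map_mul' g k := by
    ext n
    simp only [coeff_mk, coeff_mul, Finset.sum_smul]
    refine Finset.sum_congr rfl fun p hp => ?_
    rw [smul_mul_smul_comm, ← pow_add, Finset.HasAntidiagonal.mem_antidiagonal.1 hp]
  map_zero' := by ext n; simp
  map_add' g k := by ext n; simp [add_smul]
  commutes' r := by
    ext n
    by_cases hn : n = 0 <;> simp [coeff_C, hn, Algebra.algebraMap_eq_smul_one]

namespace PowerSeries

section ScaleBy

variable {R A : Type*} [CommRing R] [Ring A] [Algebra R A] (a : A)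

theorem C_mul_C_sub_of_commutator {k a : A} {c : R} (hk : k * a - a * k = c • a) :
    C k * C a - C a * C k = c • C a := by
  rw [← map_mul, ← map_mul, ← map_sub, hk]
  ext n
  rw [coeff_smul, coeff_C, coeff_C]
  split_ifs <;> simp

@[simp]
theorem coeff_scaleBy (g : PowerSeries R) (n : ℕ) :
    coeff n (scaleBy a g) = coeff n g • a ^ n := by
  simp [scaleBy]

@[simp]
theorem scaleBy_X : scaleBy a (X : PowerSeries R) = X * C a := by
  ext n
  rcases n with _ | _ | n <;> simp [coeff_X]

/-- If `k` acts on `a` with weight `c`, it acts on series in `a X` as `c X d/dX`. -/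
theorem C_mul_scaleBy_sub {a k : A} {c : R} (hk : k * a - a * k = c • a) (g : PowerSeries R) :
    C k * scaleBy a g - scaleBy a g * C k = c • scaleBy a (X * derivative R g) := by
  have hpow : ∀ n : ℕ, k * a ^ n - a ^ n * k = ((n : R) * c) • a ^ n := by
    intro n
    induction n with
    | zero => simp
    | succ n ih =>
      have : k * a ^ (n + 1) - a ^ (n + 1) * k
          = (k * a ^ n - a ^ n * k) * a + a ^ n * (k * a - a * k) := by
        rw [pow_succ]; noncomm_ring
      rw [this, ih, hk, smul_mul_assoc, mul_smul_comm, ← pow_succ, ← add_smul]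
      congr 1
      push_cast
      ring
  ext n
  have hcoeff : coeff n (X * derivative R g) = coeff n g * n := by
    cases n with
    | zero => simp
    | succ n => rw [coeff_succ_X_mul, coeff_derivative]; push_cast; rfl
  simp only [map_sub, coeff_C_mul, coeff_mul_C, coeff_scaleBy, coeff_smul, hcoeff,
    mul_smul_comm, smul_mul_assoc, ← smul_sub, hpow, smul_smul]
  congr 1
  ring

end ScaleBy

/-- The binomial series of `(1 + X) ^ (1/2)` over `ℂ`. -/
def sqrtSeries : PowerSeries ℂ := mk fun n => ((qbinom (1 / 2) n : ℚ) : ℂ)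

theorem sqrtSeries_eq_binomialSeries : sqrtSeries = binomialSeries ℂ (1 / 2 : ℚ) := by
  have hprod : ∀ (α : ℚ) (n : ℕ),
      (descPochhammer ℤ n).smeval α = ∏ i ∈ Finset.range n, (α - (i : ℚ)) := by
    intro α n
    rw [← descPochhammer_eval_eq_prod_range, ← Polynomial.aeval_eq_smeval,
      ← descPochhammer_map (algebraMap ℤ ℚ), Polynomial.eval_map_algebraMap]
  ext n
  rw [binomialSeries_coeff, Ring.choose_eq_smul, hprod, sqrtSeries, coeff_mk, qbinom,
    Rat.smul_def, mul_one, smul_eq_mul, div_eq_inv_mul]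

theorem sqrtSeries_sq : sqrtSeries ^ 2 = 1 + X := by
  rw [sqrtSeries_eq_binomialSeries, sq, ← binomialSeries_add,
    show (1 / 2 + 1 / 2 : ℚ) = ((1 : ℕ) : ℚ) by norm_num, binomialSeries_nat, pow_one]

@[simp]
theorem constantCoeff_sqrtSeries : constantCoeff sqrtSeries = 1 := by
  rw [sqrtSeries_eq_binomialSeries, binomialSeries_constantCoeff]

/-- The series of `(1 + X²) ^ (1/2)`. -/
def sqrtOneAddSq : PowerSeries ℂ := sqrtSeries.subst (X ^ 2 : PowerSeries ℂ)

theorem sqrtOneAddSq_sq : sqrtOneAddSq ^ 2 = 1 + X ^ 2 := by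
  have h : HasSubst (X ^ 2 : PowerSeries ℂ) := HasSubst.X_pow two_ne_zero
  rw [sqrtOneAddSq, ← subst_pow h, sqrtSeries_sq, ← coe_substAlgHom h, map_add, map_one,
    coe_substAlgHom, subst_X h]

theorem constantCoeff_X_add_sqrtOneAddSq_sub_one :
    constantCoeff (X + sqrtOneAddSq - 1) = 0 := by
  simp [sqrtOneAddSq, constantCoeff_subst_X_pow]

/-- The square root of `X + (1 + X²) ^ (1/2)`. -/
def sqrtXAddSqrt : PowerSeries ℂ := sqrtSeries.subst (X + sqrtOneAddSq - 1)

theorem sqrtXAddSqrt_sq : sqrtXAddSqrt ^ 2 = X + sqrtOneAddSq := by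
  have h : HasSubst (X + sqrtOneAddSq - 1) :=
    HasSubst.of_constantCoeff_zero' constantCoeff_X_add_sqrtOneAddSq_sub_one
  rw [sqrtXAddSqrt, ← subst_pow h, sqrtSeries_sq, ← coe_substAlgHom h, map_add, map_one,
    coe_substAlgHom, subst_X h]
  ring

theorem coeff_sqrtXAddSqrt (m : ℕ) :
    coeff m sqrtXAddSqrt = coeff m (∑ n ∈ Finset.range (m + 1),
      ((qbinom (1 / 2) n : ℚ) : ℂ) • (X + sqrtOneAddSq - 1) ^ n) := by
  have h0 := constantCoeff_X_add_sqrtOneAddSq_sub_one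
  rw [sqrtXAddSqrt, coeff_subst' (HasSubst.of_constantCoeff_zero' h0), map_sum,
    finsum_eq_sum_of_support_subset (s := Finset.range (m + 1))]
  · simp [sqrtSeries]
  · intro n hn
    by_contra hlt
    refine hn ?_
    have : m < n := by simpa [Nat.lt_succ_iff] using hlt
    have hdvd : X ^ n ∣ (X + sqrtOneAddSq - 1) ^ n := pow_dvd_pow_of_dvd (X_dvd_iff.2 h0) n
    simp [X_pow_dvd_iff.1 hdvd m this]

/-- The differential equation relating `V = (X + S) ^ (1/2)` and `S = (1 + X²) ^ (1/2)`. -/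
theorem X_mul_derivative_sqrtXAddSqrt :
    X * derivative ℂ sqrtXAddSqrt = (1 / 2 : ℂ) • (X * (sqrtOneAddSq - X)) *
      (2 * (X * derivative ℂ sqrtXAddSqrt) + sqrtXAddSqrt) := by
  have hs := sqrtOneAddSq_sq
  have hu := sqrtXAddSqrt_sq
  have hs' := congrArg (derivative ℂ) hs
  have hu' := congrArg (derivative ℂ) hu
  simp only [derivative_pow, map_add, derivative_one, derivative_X] at hs' hu'
  have hs0 : sqrtOneAddSq ≠ 0 := by
    intro h
    simpa [h] using congrArg constantCoeff hs
  have hu0 : sqrtXAddSqrt ≠ 0 := by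
    intro h
    have h1 := hu
    rw [h] at h1
    have h2 : sqrtOneAddSq = -X := by linear_combination -h1
    rw [h2] at hs
    simpa using congrArg constantCoeff hs
  have h20 : (2 : PowerSeries ℂ) ≠ 0 := by
    rw [← map_ofNat (C (R := ℂ)) 2]
    exact (map_ne_zero_iff _ C_injective).2 two_ne_zero
  set s := sqrtOneAddSq
  set u := sqrtXAddSqrt
  set s' := derivative ℂ s
  set u' := derivative ℂ u
  have hss : s * s' = X := by
    have : (2 : PowerSeries ℂ) * (s * s') = 2 * X := by
      push_cast at hs'; linear_combination hs'
    exact mul_left_cancel₀ h20 this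
  have huu : 2 * s * u' = u := by
    refine mul_left_cancel₀ hu0 ?_
    push_cast at hu'
    linear_combination s * hu' + hss - hu
  have hc : (2 : PowerSeries ℂ) * C (1 / 2 : ℂ) = 1 := by
    rw [← map_ofNat (C (R := ℂ)) 2, ← map_mul]
    norm_num
  rw [smul_eq_C_mul]
  refine mul_left_cancel₀ (mul_ne_zero h20 (mul_ne_zero h20 hs0)) ?_
  linear_combination 2 * X * huu - 2 * s * (X * (s - X)) * (2 * (X * u') + u) * hc
    - 2 * (X * (s - X)) * X * huu - 2 * X * u * hs

end PowerSeries

namespace UslN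

variable {N : ℕ}

/-- The image of the matrix unit `E_{ab}`, `a ≠ b`, in `U(sl(N,ℂ))`. -/
def rootVec (a b : Fin N) (h : a ≠ b) : UslN N := ι N (single a b h 1)

theorem ι_mul_sub (x y : sl (Fin N) ℂ) : ι N x * ι N y - ι N y * ι N x = ι N ⁅x, y⁆ := by
  rw [LieHom.map_lie, LieRing.of_associative_ring_bracket]

theorem rootVec_commutator (a b c : Fin N) (hab : a ≠ b) (hbc : b ≠ c) (hac : a ≠ c) :
    rootVec a b hab * rootVec b c hbc - rootVec b c hbc * rootVec a b hab = rootVec a c hac := by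
  rw [rootVec, rootVec, rootVec, ι_mul_sub]
  refine congrArg (ι N) (Subtype.ext ?_)
  rw [sl_bracket]
  simp [hac.symm]

theorem rootVec_commute (a b c d : Fin N) (hab : a ≠ b) (hcd : c ≠ d) (hbc : b ≠ c)
    (hda : d ≠ a) : Commute (rootVec a b hab) (rootVec c d hcd) := by
  rw [commute_iff_eq, ← sub_eq_zero, rootVec, rootVec, ι_mul_sub, ← (ι N).map_zero]
  refine congrArg (ι N) (Subtype.ext ?_)
  rw [sl_bracket]
  simp [hbc, hda]

theorem e_eq_rootVec {i : ℕ} (h : i + 1 < N) :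
    e N i = rootVec ⟨i, Nat.lt_of_succ_lt h⟩ ⟨i + 1, h⟩ (by simp) := by
  rw [e, dif_pos h, rootVec]

theorem thetaAux_eq_rootVec (hN : 2 ≤ N) (j : ℕ) (hj : j + 2 ≤ N) :
    thetaAux N j = rootVec ⟨N - 2 - j, by omega⟩ ⟨N - 1, by omega⟩
      (by simp only [ne_eq, Fin.mk.injEq]; omega) := by
  induction j with
  | zero =>
    rw [thetaAux, e_eq_rootVec (by omega)]
    congr 2
    omega
  | succ j ih =>
    have hidx : N - 2 - (j + 1) + 1 = N - 2 - j := by omega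
    rw [thetaAux, ih (by omega), e_eq_rootVec (by omega)]
    simp only [hidx]
    exact rootVec_commutator _ _ _ _ _ _

theorem θ_eq_rootVec (hN : 2 ≤ N) :
    θ N = rootVec ⟨0, by omega⟩ ⟨N - 1, by omega⟩
      (by simp only [ne_eq, Fin.mk.injEq]; omega) := by
  rw [θ, thetaAux_eq_rootVec hN _ (by omega)]
  congr 2
  omega

theorem θ_commute_e (hN : 2 ≤ N) {j : ℕ} (hj : j + 1 < N) : Commute (θ N) (e N j) := by
  rw [θ_eq_rootVec hN, e_eq_rootVec hj]
  apply rootVec_commute <;> simp only [ne_eq, Fin.mk.injEq] <;> omega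

/-- The `a`-th diagonal entry of `E_{ii} - E_{i+1,i+1}`. -/
def diagEntry (i a : ℕ) : ℤ := (if i = a then 1 else 0) - (if i + 1 = a then 1 else 0)

theorem hgen_eq {i : ℕ} (hi : i + 1 < N) :
    hgen N i = ι N (singleSubSingle ⟨i, Nat.lt_of_succ_lt hi⟩ ⟨i + 1, hi⟩ 1) := by
  rw [hgen, dif_pos hi]
  rfl

theorem val_singleSubSingle_eq_diagonal {i : ℕ} (hi : i + 1 < N) :
    (singleSubSingle (⟨i, Nat.lt_of_succ_lt hi⟩ : Fin N) ⟨i + 1, hi⟩ (1 : ℂ)).val =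
      Matrix.diagonal fun a : Fin N => (diagEntry i a : ℂ) := by
  ext a b
  by_cases hab : a = b
  · subst hab
    simp [Matrix.single_apply, diagEntry, Fin.ext_iff]
  · rw [val_singleSubSingle, Matrix.diagonal_apply_ne _ hab]
    simp only [Matrix.sub_apply, Matrix.single_apply]
    rw [if_neg (by rintro ⟨rfl, rfl⟩; exact hab rfl), if_neg (by rintro ⟨rfl, rfl⟩; exact hab rfl),
      sub_zero]

theorem hgen_rootVec_commutator {i : ℕ} (hi : i + 1 < N) (a b : Fin N) (hab : a ≠ b) :
    hgen N i * rootVec a b hab - rootVec a b hab * hgen N i =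
      ((diagEntry i a - diagEntry i b : ℤ) : ℂ) • rootVec a b hab := by
  rw [hgen_eq hi, rootVec, ι_mul_sub, ← map_smul (ι N)]
  refine congrArg (ι N) (Subtype.ext ?_)
  rw [sl_bracket, val_singleSubSingle_eq_diagonal]
  ext c d
  by_cases h : a = c ∧ b = d
  · obtain ⟨rfl, rfl⟩ := h
    simp
  · simp [Matrix.single_apply_of_ne _ _ _ _ _ h]

theorem hgen_commute (i j : ℕ) : Commute (hgen N i) (hgen N j) := by
  by_cases hi : i + 1 < N
  · by_cases hj : j + 1 < N
    · rw [commute_iff_eq, ← sub_eq_zero, hgen_eq hi, hgen_eq hj, ι_mul_sub, ← (ι N).map_zero]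
      refine congrArg (ι N) (Subtype.ext ?_)
      rw [sl_bracket, val_singleSubSingle_eq_diagonal, val_singleSubSingle_eq_diagonal]
      simp [mul_comm]
    · simp [hgen, hj]
  · simp [hgen, hi]

theorem hgen_commute_hsum (i : ℕ) : Commute (hgen N i) (hsum N) :=
  Commute.sum_right _ _ _ fun j _ => hgen_commute i j

theorem hgen_e_commutator {i j : ℕ} (hi : i + 1 < N) (hj : j + 1 < N) :
    hgen N i * e N j - e N j * hgen N i = ((cartan i j : ℤ) : ℂ) • e N j := by
  rw [e_eq_rootVec hj, hgen_rootVec_commutator hi]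
  congr 2
  simp only [diagEntry, cartan]
  split_ifs <;> omega

theorem hgen_θ_commutator (hN : 3 ≤ N) {i : ℕ} (hi : i + 1 < N) :
    hgen N i * θ N - θ N * hgen N i = (if δ N i then 1 else 0 : ℂ) • θ N := by
  rw [θ_eq_rootVec (by omega), hgen_rootVec_commutator hi,
    show (diagEntry i 0 - diagEntry i (N - 1) : ℤ) = if δ N i then 1 else 0 by
      by_cases h : δ N i <;> simp only [h, if_true, if_false, diagEntry] <;> unfold δ at h <;>
        split_ifs <;> first | contradiction | omega]
  split_ifs <;> simp

theorem hsum_rootVec_commutator (a b : Fin N) (hab : a ≠ b) :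
    hsum N * rootVec a b hab - rootVec a b hab * hsum N =
      ((((if 0 = (a : ℕ) then 1 else 0) - (if N - 1 = (a : ℕ) then 1 else 0)) -
        ((if 0 = (b : ℕ) then 1 else 0) - (if N - 1 = (b : ℕ) then 1 else 0)) : ℤ) : ℂ) •
        rootVec a b hab := by
  have htel : ∀ c : ℕ, ∑ i ∈ Finset.range (N - 1), diagEntry i c =
      (if 0 = c then 1 else 0) - (if N - 1 = c then 1 else 0) := fun c =>
    Finset.sum_range_sub' (fun i => if i = c then (1 : ℤ) else 0) (N - 1)
  rw [hsum, Finset.sum_mul, Finset.mul_sum, ← Finset.sum_sub_distrib,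
    Finset.sum_congr rfl fun i hi => hgen_rootVec_commutator
      (by have := Finset.mem_range.1 hi; omega) a b hab,
    ← Finset.sum_smul, ← Int.cast_sum, Finset.sum_sub_distrib, htel, htel]

theorem hsum_e_commutator (hN : 3 ≤ N) {j : ℕ} (hj : j + 1 < N) :
    hsum N * e N j - e N j * hsum N = (if δ N j then 1 else 0 : ℂ) • e N j := by
  rw [e_eq_rootVec hj, hsum_rootVec_commutator,
    show (_ - _ : ℤ) = if δ N j then 1 else 0 by
      by_cases h : δ N j <;> simp only [h, if_true, if_false] <;> unfold δ at h <;>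
        split_ifs <;> first | contradiction | omega]
  split_ifs <;> simp

theorem hsum_θ_commutator (hN : 3 ≤ N) :
    hsum N * θ N - θ N * hsum N = (2 : ℂ) • θ N := by
  rw [θ_eq_rootVec (by omega), hsum_rootVec_commutator,
    show (_ - _ : ℤ) = 2 by
      simp only
      split_ifs <;> omega]
  norm_num

open PowerSeries

theorem S_eq_scaleBy : S N = scaleBy (θ N) sqrtOneAddSq := by
  ext m
  simp only [S, coeff_mk, coeff_scaleBy, sqrtOneAddSq, coeff_subst_X_pow two_ne_zero,
    Nat.dvd_iff_mod_eq_zero, sqrtSeries]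
  split_ifs <;> simp

theorem T_eq_scaleBy : T N = scaleBy (θ N) (X + sqrtOneAddSq) := by
  rw [T, S_eq_scaleBy, map_add, scaleBy_X]

theorem Tinv_eq_scaleBy : Tinv N = scaleBy (θ N) (sqrtOneAddSq - X) := by
  rw [Tinv, S_eq_scaleBy, map_sub, scaleBy_X, neg_add_eq_sub]

theorem Thalf_eq_scaleBy : Thalf N = scaleBy (θ N) sqrtXAddSqrt := by
  ext m
  rw [Thalf, coeff_mk, coeff_scaleBy, coeff_sqrtXAddSqrt, ← coeff_scaleBy, T_eq_scaleBy]
  refine congrArg (coeff m) ?_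
  rw [map_sum]
  refine Finset.sum_congr rfl fun n _ => ?_
  rw [map_smul, map_pow, map_sub, map_one]

/-- The series `φ` such that `H_i = h_i - δ_i φ(hθ) (h₁ + ⋯ + h_{N-1})`. -/
def cartanTwist : PowerSeries ℂ := (1 / 2 : ℂ) • (X * (sqrtOneAddSq - X))

theorem H_of_δ {i : ℕ} (hi : δ N i) :
    H N i = C (hgen N i) - scaleBy (θ N) cartanTwist * C (hsum N) := by
  rw [H, if_pos hi, Tinv_eq_scaleBy, cartanTwist, map_smul, map_mul, scaleBy_X, smul_mul_assoc]

theorem H_of_not_δ {i : ℕ} (hi : ¬ δ N i) : H N i = C (hgen N i) := by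
  rw [H, if_neg hi, sub_zero]

theorem C_hgen_scaleBy_of_δ (hN : 3 ≤ N) {i : ℕ} (hi : i + 1 < N) (hd : δ N i)
    (g : PowerSeries ℂ) :
    C (hgen N i) * scaleBy (θ N) g - scaleBy (θ N) g * C (hgen N i) =
      scaleBy (θ N) (X * derivative ℂ g) := by
  rw [C_mul_scaleBy_sub (hgen_θ_commutator hN hi), if_pos hd, one_smul]

theorem C_hgen_scaleBy_of_not_δ (hN : 3 ≤ N) {i : ℕ} (hi : i + 1 < N) (hd : ¬ δ N i)
    (g : PowerSeries ℂ) :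
    C (hgen N i) * scaleBy (θ N) g - scaleBy (θ N) g * C (hgen N i) = 0 := by
  rw [C_mul_scaleBy_sub (hgen_θ_commutator hN hi), if_neg hd, zero_smul]

theorem C_hsum_scaleBy (hN : 3 ≤ N) (g : PowerSeries ℂ) :
    C (hsum N) * scaleBy (θ N) g - scaleBy (θ N) g * C (hsum N) =
      2 * scaleBy (θ N) (X * derivative ℂ g) := by
  rw [C_mul_scaleBy_sub (hsum_θ_commutator hN), ofNat_smul_eq_nsmul ℂ 2, nsmul_eq_mul]
  rfl

theorem C_e_scaleBy (hN : 2 ≤ N) {j : ℕ} (hj : j + 1 < N) (g : PowerSeries ℂ) :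
    C (e N j) * scaleBy (θ N) g - scaleBy (θ N) g * C (e N j) = 0 := by
  have h : e N j * θ N - θ N * e N j = (0 : ℂ) • θ N := by
    rw [zero_smul, sub_eq_zero]
    exact (θ_commute_e hN hj).symm.eq
  rw [C_mul_scaleBy_sub h, zero_smul]

theorem C_hgen_hgen (i j : ℕ) :
    C (hgen N i) * C (hgen N j) - C (hgen N j) * C (hgen N i) = 0 :=
  sub_eq_zero.2 ((hgen_commute i j).map C).eq

theorem C_hgen_hsum (i : ℕ) :
    C (hgen N i) * C (hsum N) - C (hsum N) * C (hgen N i) = 0 :=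
  sub_eq_zero.2 ((hgen_commute_hsum i).map C).eq

theorem H_commutator_H (hN : 3 ≤ N) {i j : ℕ} (hi : i + 1 < N) (hj : j + 1 < N) :
    H N i * H N j - H N j * H N i = 0 := by
  have hij := C_hgen_hgen (N := N) i j
  have hiK := C_hgen_hsum (N := N) i
  have hjK := C_hgen_hsum (N := N) j
  set F := scaleBy (θ N) cartanTwist
  set K := C (hsum N)
  by_cases di : δ N i <;> by_cases dj : δ N j
  · have hiF := C_hgen_scaleBy_of_δ hN hi di cartanTwist
    have hjF := C_hgen_scaleBy_of_δ hN hj dj cartanTwist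
    rw [H_of_δ di, H_of_δ dj]
    linear_combination (norm := noncomm_ring) hij - hiF * K - F * hiK + hjF * K + F * hjK
  · have hjF := C_hgen_scaleBy_of_not_δ hN hj dj cartanTwist
    rw [H_of_δ di, H_of_not_δ dj]
    linear_combination (norm := noncomm_ring) hij + hjF * K + F * hjK
  · have hiF := C_hgen_scaleBy_of_not_δ hN hi di cartanTwist
    rw [H_of_not_δ di, H_of_δ dj]
    linear_combination (norm := noncomm_ring) hij - hiF * K - F * hiK
  · rw [H_of_not_δ di, H_of_not_δ dj, hij]

theorem H_commutator_E (hN : 3 ≤ N) {i j : ℕ} (hi : i + 1 < N) (hj : j + 1 < N) :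
    H N i * E N j - E N j * H N i = ((cartan i j : ℤ) : ℂ) • E N j := by
  have hie := C_mul_C_sub_of_commutator (hgen_e_commutator hi hj)
  have hKe := C_mul_C_sub_of_commutator (hsum_e_commutator hN hj)
  have heF := C_e_scaleBy (by omega : 2 ≤ N) hj cartanTwist
  have hKV := C_hsum_scaleBy hN sqrtXAddSqrt
  have hFV : scaleBy (θ N) cartanTwist * scaleBy (θ N) sqrtXAddSqrt
      - scaleBy (θ N) sqrtXAddSqrt * scaleBy (θ N) cartanTwist = 0 := by
    rw [← map_mul, ← map_mul, mul_comm, sub_self]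
  have hode : scaleBy (θ N) (X * derivative ℂ sqrtXAddSqrt) = scaleBy (θ N) cartanTwist *
      (2 * scaleBy (θ N) (X * derivative ℂ sqrtXAddSqrt) + scaleBy (θ N) sqrtXAddSqrt) := by
    conv_lhs => rw [X_mul_derivative_sqrtXAddSqrt]
    rw [map_mul, map_add, map_mul, map_ofNat, cartanTwist]
  by_cases dj : δ N j
  · rw [if_pos dj, one_smul] at hKe
    rw [E, if_pos dj, Thalf_eq_scaleBy, ← mul_smul_comm]
    generalize ((cartan i j : ℤ) : ℂ) • C (e N j) = z at hie ⊢
    set F := scaleBy (θ N) cartanTwist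
    set V := scaleBy (θ N) sqrtXAddSqrt
    set K := C (hsum N)
    by_cases di : δ N i
    · have hiV := C_hgen_scaleBy_of_δ hN hi di sqrtXAddSqrt
      rw [H_of_δ di]
      linear_combination (norm := noncomm_ring) hiV * C (e N j) + V * hie
        - F * hKV * C (e N j) - F * V * hKe - hFV * C (e N j) * K + V * heF * K
        + hode * C (e N j)
    · have hiV := C_hgen_scaleBy_of_not_δ hN hi di sqrtXAddSqrt
      rw [H_of_not_δ di]
      linear_combination (norm := noncomm_ring) hiV * C (e N j) + V * hie
  · rw [if_neg dj, zero_smul] at hKe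
    rw [E, if_neg dj]
    by_cases di : δ N i
    · rw [H_of_δ di]
      linear_combination (norm := noncomm_ring) hie - scaleBy (θ N) cartanTwist * hKe
        + heF * C (hsum N)
    · rw [H_of_not_δ di, hie]

end UslN

open UslN in
/-- In `R = U(sl(N,ℂ))[[h]]` (Jordanian deformation of `sl(N)`, `N ≥ 3`): for all
simple-root indices `i, j` (0-based, so `i, j < N - 1`), `[H_i,H_j] = 0` and
`[H_i,E_j] = a_{ij}·E_j`, where `a` is the Cartan matrix of `sl(N)`. -/
theorem statement_11 (N : ℕ) (hN : 3 ≤ N) (i j : ℕ) (hi : i < N - 1) (hj : j < N - 1) :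
    H N i * H N j - H N j * H N i = 0 ∧
    H N i * E N j - E N j * H N i = ((cartan i j : ℤ) : ℂ) • E N j := by
  exact ⟨H_commutator_H hN (by omega) (by omega), H_commutator_E hN (by omega) (by omega)⟩
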